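/- For every real ε > 0 there exists a 3-graph F such that the uniform Turán density satisfies π_⸫(F) ≥ 4/27 and the codegree Turán density satisfies π_co(F) ≤ ε. -/

import Mathlib

open Finset

structure ThreeGraph (V : Type*) where
  edges : Finset (Finset V)
  card_eq : ∀ e ∈ edges, e.card = 3

variable {α β : Type*}

/-- `H` contains a copy of `F`. -/
def HasCopy [DecidableEq β] (H : ThreeGraph β) (F : ThreeGraph α) : Prop :=
  ∃ φ : α → β, Function.Injective φ ∧ ∀ e ∈ F.edges, e.image φ ∈ H.edges

/-- The codegree of a pair of vertices. -/
def codeg [DecidableEq β] [Fintype β] (H : ThreeGraph β) (u v : β) : ℕ :=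
  (Finset.univ.filter (fun w => ({u, v, w} : Finset β) ∈ H.edges)).card

/-- The codegree Turán density of a 3-graph `F`. -/
noncomputable def piCo (F : ThreeGraph α) : ℝ :=
  sSup {x : ℝ | 0 ≤ x ∧ x ≤ 1 ∧ ∀ n₀ : ℕ, ∃ n : ℕ, n₀ ≤ n ∧ ∃ H : ThreeGraph (Fin n),
    ¬ HasCopy H F ∧ ∀ u v : Fin n, u ≠ v → x * n ≤ (codeg H u v : ℝ)}

/-- An `n`-vertex 3-graph is uniformly `(d, η)`-dense. -/
def UniformlyDense {n : ℕ} (H : ThreeGraph (Fin n)) (d η : ℝ) : Prop :=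
  ∀ U : Finset (Fin n),
    d * (U.card.choose 3 : ℝ) - η * (n : ℝ) ^ 3 ≤ ((H.edges.filter (fun e => e ⊆ U)).card : ℝ)

/-- The uniform Turán density of a 3-graph `F`. -/
noncomputable def piUnif (F : ThreeGraph α) : ℝ :=
  sSup {d : ℝ | 0 ≤ d ∧ d ≤ 1 ∧ ∀ η : ℝ, 0 < η → ∀ n₀ : ℕ, ∃ n : ℕ, n₀ ≤ n ∧
    ∃ H : ThreeGraph (Fin n), ¬ HasCopy H F ∧ UniformlyDense H d η}

/-- `f` is a layered function of the 3-graph with edge set `E`. -/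
def IsLayeredFunction [DecidableEq α] (E : Finset (Finset α)) (f : α → ℕ) : Prop :=
  (∀ e ∈ E, ∃ w ∈ e, ∀ u ∈ e, u ≠ w → f u < f w) ∧
  (∀ e₁ ∈ E, ∀ e₂ ∈ E, e₁.sup f = e₂.sup f → Multiset.map f e₁.val = Multiset.map f e₂.val) ∧
  (∀ e₁ ∈ E, ∀ e₂ ∈ E, ∀ u v w u' v' w' : α,
    u ≠ v → u ≠ w → v ≠ w → u' ≠ v' → u' ≠ w' → v' ≠ w' →
    e₁ = {u, v, w} → e₂ = {u', v', w'} →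
    f u = f u' → f v = f v' → f w = f w')

/-- A 3-graph is layered if it admits a layered function. -/
def IsLayered [DecidableEq α] (F : ThreeGraph α) : Prop :=
  ∃ f : α → ℕ, IsLayeredFunction F.edges f



/-! ### Cut-norm estimate -/

/-- The centred indicator of the colour `0` among three colours. -/
noncomputable def centredRed (z : Fin 3) : ℝ := if z = 0 then 2 / 3 else -1 / 3

lemma sum_sq_centredRed_le (M : ℕ) (V : Fin M → ℝ) :
    ∑ x : Fin M → Fin 3, (∑ i, V i * centredRed (x i)) ^ 2 ≤ 3 ^ M * ∑ i, V i ^ 2 := by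
  induction M with
  | zero => simp
  | succ M ih =>
    rw [← (Fin.consEquiv (fun _ => Fin 3)).sum_comp, Fintype.sum_prod_type,
      Fin.sum_univ_three]
    simp only [Fin.consEquiv, Equiv.coe_fn_mk, Fin.sum_univ_succ, Fin.cons_zero, Fin.cons_succ]
    rw [← Finset.sum_add_distrib, ← Finset.sum_add_distrib]
    have key : ∀ x : Fin M → Fin 3,
        (V 0 * centredRed 0 + ∑ i, V i.succ * centredRed (x i)) ^ 2
        + (V 0 * centredRed 1 + ∑ i, V i.succ * centredRed (x i)) ^ 2
        + (V 0 * centredRed 2 + ∑ i, V i.succ * centredRed (x i)) ^ 2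
        = 2 / 3 * V 0 ^ 2 + 3 * (∑ i, V i.succ * centredRed (x i)) ^ 2 := by
      intro x
      simp [centredRed]
      ring
    simp only [key]
    rw [Finset.sum_add_distrib, ← Finset.mul_sum (a := 3)]
    have := ih (fun i => V i.succ)
    simp only [Finset.sum_const, Finset.card_univ, Fintype.card_pi, Fintype.card_fin,
      Finset.prod_const, nsmul_eq_mul]
    push_cast
    have h3 : (0 : ℝ) ≤ 3 ^ M * V 0 ^ 2 := by positivity
    rw [pow_succ (3 : ℝ) M]
    nlinarith

lemma sum_abs_centredRed_le (M : ℕ) (V : Fin M → ℝ) (hV : ∀ i, |V i| ≤ 3 ^ M) :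
    ∑ x : Fin M → Fin 3, |∑ i, V i * centredRed (x i)| ≤ 9 ^ M * √M := by
  refine abs_le_of_sq_le_sq' ?_ (by positivity) |>.2
  have h1 := sq_sum_le_card_mul_sum_sq (s := (Finset.univ : Finset (Fin M → Fin 3)))
    (f := fun x => |∑ i, V i * centredRed (x i)|)
  simp only [sq_abs, Finset.card_univ, Fintype.card_pi, Fintype.card_fin,
      Finset.prod_const] at h1
  push_cast at h1
  have h2 := sum_sq_centredRed_le M V
  have h3 : ∑ i, V i ^ 2 ≤ M * 9 ^ M := by
    calc ∑ i, V i ^ 2 ≤ ∑ _i : Fin M, (9 : ℝ) ^ M := by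
          refine Finset.sum_le_sum fun i _ => ?_
          have := sq_le_sq.2 ((hV i).trans (le_abs_self _))
          rwa [← pow_mul, mul_comm M, pow_mul, show (3 : ℝ) ^ 2 = 9 by norm_num] at this
      _ = _ := by simp
  have h9 : (9 : ℝ) ^ M = 3 ^ M * 3 ^ M := by rw [← mul_pow]; norm_num
  calc _ ≤ _ := h1
    _ ≤ 3 ^ M * (3 ^ M * (M * 9 ^ M)) := by gcongr; exact h2.trans (by gcongr)
    _ = _ := by rw [mul_pow, Real.sq_sqrt (by positivity)]; rw [h9]; ring

/-- Vertices of the palette construction: a level, and a colour towards every level. -/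
abbrev PaletteVertex (M : ℕ) := Fin M × (Fin M → Fin 3)

lemma card_paletteVertex (M : ℕ) : Fintype.card (PaletteVertex M) = M * 3 ^ M := by
  simp

lemma abs_sum_centredRed_le {M : ℕ} (u v : PaletteVertex M → ℝ) (hu : ∀ p, |u p| ≤ 1)
    (hv : ∀ p, |v p| ≤ 1) :
    |∑ p, ∑ q, if p.1 < q.1 then u p * v q * centredRed (p.2 q.1) else 0|
      ≤ M * (9 ^ M * √M) := by
  rw [Fintype.sum_prod_type]
  refine (Finset.abs_sum_le_sum_abs _ _).trans ?_
  have : ∀ y : Fin M, |∑ x : Fin M → Fin 3, ∑ q : PaletteVertex M,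
      if y < q.1 then u (y, x) * v q * centredRed (x q.1) else 0| ≤ 9 ^ M * √M := by
    intro y
    refine le_trans ?_ (sum_abs_centredRed_le M
      (fun i => if y < i then ∑ x', v (i, x') else 0) ?_)
    · refine (Finset.abs_sum_le_sum_abs _ _).trans (Finset.sum_le_sum fun x _ => ?_)
      have : ∑ q : PaletteVertex M,
          (if y < q.1 then u (y, x) * v q * centredRed (x q.1) else 0)
          = u (y, x) * ∑ i, (if y < i then ∑ x', v (i, x') else 0) * centredRed (x i) := by
        rw [Fintype.sum_prod_type, Finset.mul_sum]
        refine Finset.sum_congr rfl fun i _ => ?_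
        by_cases h : y < i
        · simp only [h, if_true, Finset.sum_mul, Finset.mul_sum, mul_assoc]
        · simp [h]
      rw [this, abs_mul]
      exact mul_le_of_le_one_left (abs_nonneg _) (hu _)
    · intro i
      split_ifs
      · refine (Finset.abs_sum_le_sum_abs _ _).trans ?_
        refine (Finset.sum_le_sum fun x _ => hv (i, x)).trans ?_
        simp
      · simp
  refine (Finset.sum_le_sum fun y _ => this y).trans ?_
  simp

/-- The increasing triples of the palette construction that form edges: the bottom pair is red
and the other two pairs are blue. -/
def PaletteEdge {M : ℕ} (p q r : PaletteVertex M) : Prop :=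
  (p.1 < q.1 ∧ q.1 < r.1) ∧ p.2 q.1 = 0 ∧ p.2 r.1 ≠ 0 ∧ q.2 r.1 ≠ 0

open Classical in
lemma card_paletteEdge_ge {M : ℕ} (U : Finset (PaletteVertex M)) :
    4 / 27 * (#{t ∈ U ×ˢ U ×ˢ U | t.1.1 < t.2.1.1 ∧ t.2.1.1 < t.2.2.1} : ℝ)
      - 14 / 9 * ((M * 3 ^ M) * (M * (9 ^ M * √M)))
    ≤ #{t ∈ U ×ˢ U ×ˢ U | PaletteEdge t.1 t.2.1 t.2.2} := by
  set B : ℝ := M * (9 ^ M * √M)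
  let c : PaletteVertex M → PaletteVertex M → ℝ := fun p q => centredRed (p.2 q.1)
  let b : PaletteVertex M → PaletteVertex M → ℝ := fun p q => if p.2 q.1 = 0 then 0 else 1
  let I : PaletteVertex M → ℝ := fun p => if p ∈ U then 1 else 0
  let L : PaletteVertex M → PaletteVertex M → ℝ := fun p q => if p.1 < q.1 then 1 else 0
  have hI : ∀ p, |I p| ≤ 1 := fun p => by simp only [I]; split_ifs <;> simp
  have hb : ∀ p q, |b p q| ≤ 1 := fun p q => by simp only [b]; split_ifs <;> simp
  have hL : ∀ p q, |L p q| ≤ 1 := fun p q => by simp only [L]; split_ifs <;> simp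
  have mul1 : ∀ {x y : ℝ}, |x| ≤ 1 → |y| ≤ 1 → |x * y| ≤ 1 := fun hx hy => by
    rw [abs_mul]; exact mul_le_one₀ hx (abs_nonneg _) hy
  have cut : ∀ u v : PaletteVertex M → ℝ, (∀ p, |u p| ≤ 1) → (∀ p, |v p| ≤ 1) →
      |∑ p, ∑ q, L p q * c p q * (u p * v q)| ≤ B := by
    intro u v hu hv
    refine le_of_eq_of_le ?_ (abs_sum_centredRed_le u v hu hv)
    congr 1
    refine Finset.sum_congr rfl fun p _ => Finset.sum_congr rfl fun q _ => ?_
    simp only [L, c]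
    split_ifs <;> ring
  have total : ∀ f : PaletteVertex M → ℝ, (∀ p, |f p| ≤ B) →
      |∑ p, f p| ≤ (M * 3 ^ M) * B := by
    intro f hf
    refine (Finset.abs_sum_le_sum_abs _ _).trans ((Finset.sum_le_sum fun p _ => hf p).trans ?_)
    simp
  have tA : |∑ r, ∑ p, ∑ q, L p q * c p q * ((I p * b p r * L p r * I r) * (I q * b q r * L q r))|
      ≤ (M * 3 ^ M) * B := total _ fun r => cut _ _
        (fun p => mul1 (mul1 (mul1 (hI _) (hb _ _)) (hL _ _)) (hI _))
        (fun p => mul1 (mul1 (hI _) (hb _ _)) (hL _ _))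
  have tB : |∑ q, ∑ p, ∑ r, L p r * c p r * ((I p * L p q * I q) * (I r * b q r * L q r))|
      ≤ (M * 3 ^ M) * B := total _ fun q => cut _ _
        (fun p => mul1 (mul1 (hI _) (hL _ _)) (hI _))
        (fun p => mul1 (mul1 (hI _) (hb _ _)) (hL _ _))
  have tC : |∑ p, ∑ q, ∑ r, L q r * c q r * ((I q * L p q * I p) * I r)|
      ≤ (M * 3 ^ M) * B := total _ fun p => cut _ _
        (fun q => mul1 (mul1 (hI _) (hL _ _)) (hI _)) (fun r => hI _)
  rw [Finset.sum_comm] at tB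
  have e1 : ∑ r, ∑ p, ∑ q, L p q * c p q * ((I p * b p r * L p r * I r) * (I q * b q r * L q r))
      = ∑ p, ∑ q, ∑ r,
        L p q * c p q * ((I p * b p r * L p r * I r) * (I q * b q r * L q r)) := by
    rw [Finset.sum_comm]
    exact Finset.sum_congr rfl fun p _ => Finset.sum_comm
  rw [e1] at tA
  have cardsum : ∀ P : PaletteVertex M → PaletteVertex M → PaletteVertex M → Prop,
      ∀ [∀ p q r, Decidable (P p q r)], (#{t ∈ U ×ˢ U ×ˢ U | P t.1 t.2.1 t.2.2} : ℝ)
      = ∑ p, ∑ q, ∑ r, I p * I q * I r * (if P p q r then 1 else 0) := by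
    intro P _
    have restrict : ∀ g : PaletteVertex M → ℝ, ∑ p ∈ U, g p = ∑ p, I p * g p := fun g => by
      simp [I]
    simp only [Finset.natCast_card_filter, Finset.sum_product, restrict, Finset.mul_sum, mul_assoc]
  rw [cardsum (fun p q r => p.1 < q.1 ∧ q.1 < r.1), cardsum PaletteEdge]
  have expand : ∀ p q r, I p * I q * I r * (if PaletteEdge p q r then 1 else 0) =
      4 / 27 * (I p * I q * I r * (if p.1 < q.1 ∧ q.1 < r.1 then 1 else 0))
      + L p q * c p q * ((I p * b p r * L p r * I r) * (I q * b q r * L q r))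
      - 1 / 3 * (L p r * c p r * ((I p * L p q * I q) * (I r * b q r * L q r)))
      - 2 / 9 * (L q r * c q r * ((I q * L p q * I p) * I r)) := by
    intro p q r
    simp only [L]
    by_cases h1 : p.1 < q.1
    · by_cases h2 : q.1 < r.1
      · have h3 := h1.trans h2
        simp only [PaletteEdge, h1, h2, h3, b, c, centredRed]
        by_cases k1 : p.2 q.1 = 0 <;> by_cases k2 : p.2 r.1 = 0 <;> by_cases k3 : q.2 r.1 = 0 <;>
          simp [k1, k2, k3] <;> ring
      · simp [PaletteEdge, h1, h2]
    · simp [PaletteEdge, h1]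
  simp only [expand, Finset.sum_sub_distrib, Finset.sum_add_distrib, ← Finset.mul_sum]
  have a1 := (abs_le.1 tA).1
  simp only [← Finset.mul_sum] at a1
  have a2 := (abs_le.1 tB).2
  have a3 := (abs_le.1 tC).2
  linarith

/-! ### The palette construction -/

/-- The number of pairs of vertices on a common level. -/
lemma card_filter_level_eq {M : ℕ} :
    #{t : PaletteVertex M × PaletteVertex M × PaletteVertex M | t.1.1 = t.2.1.1}
      = M * 3 ^ M * 3 ^ M * (M * 3 ^ M) := by
  have : (Finset.univ.filter
      fun t : PaletteVertex M × PaletteVertex M × PaletteVertex M => t.1.1 = t.2.1.1) =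
      Finset.univ.image fun s : (PaletteVertex M × (Fin M → Fin 3)) × PaletteVertex M =>
        (s.1.1, (s.1.1.1, s.1.2), s.2) := by
    ext ⟨⟨a, x⟩, ⟨b, y⟩, r⟩
    simp only [Finset.mem_filter, Finset.mem_univ, true_and, Finset.mem_image, Prod.mk.injEq,
      Prod.exists]
    constructor
    · rintro rfl
      exact ⟨a, x, y, r.1, r.2, by simp⟩
    · rintro ⟨_, _, _, _, _, ⟨rfl, rfl⟩, ⟨rfl, rfl⟩, _⟩
      rfl
  rw [this, Finset.card_image_of_injective]
  · simp
  · rintro ⟨⟨⟨a, x⟩, y⟩, r⟩ ⟨⟨⟨a', x'⟩, y'⟩, r'⟩ h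
    simp_all

lemma choose_three_le_card_increasing {M : ℕ} (U : Finset (PaletteVertex M)) :
    (#U).choose 3 ≤ #{t ∈ U ×ˢ U ×ˢ U | t.1.1 < t.2.1.1 ∧ t.2.1.1 < t.2.2.1}
      + M * 3 ^ M * 3 ^ M * (M * 3 ^ M) := by
  rw [← card_filter_level_eq, ← Finset.card_powersetCard]
  let toSet : PaletteVertex M × PaletteVertex M × PaletteVertex M → Finset (PaletteVertex M) :=
    fun t => {t.1, t.2.1, t.2.2}
  refine le_trans (Finset.card_le_card ?_) ((Finset.card_union_le _ _).trans
    (Nat.add_le_add (Finset.card_image_le (f := toSet)) (Finset.card_image_le (f := toSet))))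
  intro e he
  rw [Finset.mem_powersetCard] at he
  obtain ⟨heU, hcard⟩ := he
  obtain ⟨a, b, c, -, -, -, rfl⟩ := Finset.card_eq_three.1 hcard
  have ha : a ∈ U := heU (by simp)
  have hb : b ∈ U := heU (by simp)
  have hc : c ∈ U := heU (by simp)
  have inc : ∀ p q r, p ∈ U → q ∈ U → r ∈ U → p.1 < q.1 → q.1 < r.1 →
      ({p, q, r} : Finset _) = {a, b, c} → ({a, b, c} : Finset _) ∈
        ((U ×ˢ U ×ˢ U).filter fun t => t.1.1 < t.2.1.1 ∧ t.2.1.1 < t.2.2.1).image toSet := by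
    intro p q r hp hq hr h1 h2 h3
    exact Finset.mem_image.2 ⟨(p, q, r), by simp [*], h3⟩
  have lev : ∀ p q r : PaletteVertex M, p.1 = q.1 →
      ({p, q, r} : Finset _) = {a, b, c} → ({a, b, c} : Finset _) ∈
        (Finset.univ.filter fun t : PaletteVertex M × PaletteVertex M × PaletteVertex M =>
          t.1.1 = t.2.1.1).image toSet := by
    intro p q r h1 h3
    exact Finset.mem_image.2 ⟨(p, q, r), by simp [*], h3⟩
  rw [Finset.mem_union]
  rcases lt_trichotomy a.1 b.1 with h1 | h1 | h1
  · rcases lt_trichotomy b.1 c.1 with h2 | h2 | h2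
    · exact .inl (inc a b c ha hb hc h1 h2 rfl)
    · exact .inr (lev b c a h2 (by grind))
    · rcases lt_trichotomy a.1 c.1 with h3 | h3 | h3
      · exact .inl (inc a c b ha hc hb h3 h2 (by grind))
      · exact .inr (lev a c b h3 (by grind))
      · exact .inl (inc c a b hc ha hb h3 h1 (by grind))
  · exact .inr (lev a b c h1 rfl)
  · rcases lt_trichotomy a.1 c.1 with h2 | h2 | h2
    · exact .inl (inc b a c hb ha hc h1 h2 (by grind))
    · exact .inr (lev a c b h2 (by grind))
    · rcases lt_trichotomy b.1 c.1 with h3 | h3 | h3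
      · exact .inl (inc b c a hb hc ha h3 h2 (by grind))
      · exact .inr (lev b c a h3 (by grind))
      · exact .inl (inc c b a hc hb ha h3 h1 (by grind))

lemma eq_of_triple_eq {V L : Type*} [DecidableEq V] [LinearOrder L] (lev : V → L)
    {a b c p q r : V} (h : ({a, b, c} : Finset V) = {p, q, r}) (hab : lev a ≤ lev b)
    (hbc : lev b ≤ lev c) (hpq : lev p < lev q) (hqr : lev q < lev r) :
    a = p ∧ b = q ∧ c = r := by
  have hp : p ∈ ({a, b, c} : Finset V) := h ▸ by simp
  have hq : q ∈ ({a, b, c} : Finset V) := h ▸ by simp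
  have hr : r ∈ ({a, b, c} : Finset V) := h ▸ by simp
  simp only [Finset.mem_insert, Finset.mem_singleton] at hp hq hr
  rcases hp with rfl | rfl | rfl <;> rcases hq with rfl | rfl | rfl <;>
    rcases hr with rfl | rfl | rfl <;> first | exact ⟨rfl, rfl, rfl⟩ | (exfalso; order)

lemma PaletteEdge.card_eq_three {M n : ℕ} (σ : Fin n ≃ PaletteVertex M) {p q r : Fin n}
    (h : PaletteEdge (σ p) (σ q) (σ r)) : #({p, q, r} : Finset (Fin n)) = 3 := by
  obtain ⟨⟨h1, h2⟩, -⟩ := h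
  refine Finset.card_eq_three.2 ⟨p, q, r, ?_, ?_, ?_, rfl⟩ <;> rintro rfl
  · exact h1.false
  · exact (h1.trans h2).false
  · exact h2.false

open Classical in
/-- The palette construction, with vertices relabelled by `σ`. -/
noncomputable def paletteGraph {M n : ℕ} (σ : Fin n ≃ PaletteVertex M) : ThreeGraph (Fin n) where
  edges := {e | ∃ p q r, e = {p, q, r} ∧ PaletteEdge (σ p) (σ q) (σ r)}
  card_eq := by
    intro e he
    obtain ⟨p, q, r, rfl, h⟩ := (Finset.mem_filter.1 he).2
    exact h.card_eq_three σ

open Classical in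
lemma card_paletteEdge_le {M n : ℕ} (σ : Fin n ≃ PaletteVertex M) (U : Finset (Fin n)) :
    #{t ∈ U.map σ.toEmbedding ×ˢ U.map σ.toEmbedding ×ˢ U.map σ.toEmbedding |
      PaletteEdge t.1 t.2.1 t.2.2} ≤ #{e ∈ (paletteGraph σ).edges | e ⊆ U} := by
  refine Finset.card_le_card_of_injOn (fun t => {σ.symm t.1, σ.symm t.2.1, σ.symm t.2.2}) ?_ ?_
  · rintro ⟨p, q, r⟩ ht
    simp only [Finset.coe_filter, Finset.mem_product, Finset.mem_map_equiv, Set.mem_ofPred_eq] at ht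
    simp only [paletteGraph, Finset.coe_filter, Finset.mem_filter, Finset.mem_univ, true_and,
      Set.mem_ofPred_eq]
    refine ⟨⟨_, _, _, rfl, by simpa using ht.2⟩, ?_⟩
    intro x hx
    simp only [Finset.mem_insert, Finset.mem_singleton] at hx
    rcases hx with rfl | rfl | rfl
    exacts [ht.1.1, ht.1.2.1, ht.1.2.2]
  · rintro ⟨p, q, r⟩ ht ⟨p', q', r'⟩ ht' h
    have h1 : p.1 < q.1 ∧ q.1 < r.1 := (Finset.mem_filter.1 ht).2.1
    have h2 : p'.1 < q'.1 ∧ q'.1 < r'.1 := (Finset.mem_filter.1 ht').2.1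
    have h3 : ({p, q, r} : Finset (PaletteVertex M)) = {p', q', r'} := by
      have := congrArg (Finset.image σ) h
      simpa [Finset.image_insert] using this
    obtain ⟨rfl, rfl, rfl⟩ := eq_of_triple_eq Prod.fst h3 h1.1.le h1.2.le h2.1 h2.2
    rfl

lemma uniformlyDense_paletteGraph {M n : ℕ} (σ : Fin n ≃ PaletteVertex M) {η : ℝ} (hM : 0 < M)
    (hη : 2 ≤ η * √M) : UniformlyDense (paletteGraph σ) (4 / 27) η := by
  classical
  intro U
  have hn : n = M * 3 ^ M := by
    rw [← card_paletteVertex, ← Fintype.card_congr σ, Fintype.card_fin]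
  have h1 := card_paletteEdge_ge (U.map σ.toEmbedding)
  have h2 := choose_three_le_card_increasing (U.map σ.toEmbedding)
  rw [Finset.card_map, ← Nat.cast_le (α := ℝ)] at h2
  have h3 := (Nat.cast_le (α := ℝ)).2 (card_paletteEdge_le σ U)
  push_cast at h2
  have hs : √(M : ℝ) * √M = M := Real.mul_self_sqrt (by positivity)
  have hs1 : 1 ≤ √(M : ℝ) := Real.one_le_sqrt.2 (by exact_mod_cast hM)
  have h9 : (9 : ℝ) ^ M = 3 ^ M * 3 ^ M := by rw [← mul_pow]; norm_num
  have hX : (M : ℝ) * 3 ^ M * (M * (9 ^ M * √M)) = (M ^ 2 * (3 ^ M) ^ 3) * √M := by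
    rw [h9]; ring
  have hY : (M : ℝ) * 3 ^ M * 3 ^ M * (M * 3 ^ M) ≤ (M ^ 2 * (3 ^ M) ^ 3) * √M := by
    calc (M : ℝ) * 3 ^ M * 3 ^ M * (M * 3 ^ M) = (M ^ 2 * (3 ^ M) ^ 3) * 1 := by ring
      _ ≤ _ := by gcongr
  have hZ : 2 * ((M ^ 2 * (3 ^ M) ^ 3) * √(M : ℝ)) ≤ η * (n : ℝ) ^ 3 := by
    calc 2 * ((M ^ 2 * (3 ^ M) ^ 3) * √(M : ℝ)) ≤
        (η * √M) * ((M ^ 2 * (3 ^ M) ^ 3) * √(M : ℝ)) := by gcongr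
      _ = η * ((√M * √M) * (M ^ 2 * (3 ^ M) ^ 3)) := by ring
      _ = η * (n : ℝ) ^ 3 := by rw [hs, hn]; push_cast; ring
  have hpos : (0 : ℝ) ≤ (M ^ 2 * (3 ^ M) ^ 3) * √M := by positivity
  rw [hX] at h1
  linarith

/-! ### The universal product of well-covered 3-graphs -/

/-- A 3-uniform family in which every pair of vertices has codegree at least two. -/
def IsTwoCovered {A : Type} [DecidableEq A] (E : Finset (Finset A)) : Prop :=
  (∀ e ∈ E, #e = 3) ∧ ∀ a b : A, a ≠ b → ∃ c d, c ≠ d ∧ {a, b, c} ∈ E ∧ {a, b, d} ∈ E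

/-- The type of all 3-graphs on `A` in which every pair has codegree at least two. -/
abbrev TwoCovered (A : Type) [DecidableEq A] := {E : Finset (Finset A) // IsTwoCovered E}

lemma nonempty_twoCovered {A : Type} [DecidableEq A] [Fintype A] (hA : 4 ≤ Fintype.card A) :
    Nonempty (TwoCovered A) := by
  refine ⟨⟨Finset.powersetCard 3 Finset.univ, by simp, fun a b hab => ?_⟩⟩
  obtain ⟨c, hc⟩ := Finset.exists_mem_notMem_of_card_lt_card
    (s := {a, b}) (t := Finset.univ) (lt_of_le_of_lt Finset.card_le_two (by simp; omega))
  obtain ⟨d, hd⟩ := Finset.exists_mem_notMem_of_card_lt_card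
    (s := {a, b, c}) (t := Finset.univ) (lt_of_le_of_lt Finset.card_le_three (by simp; omega))
  simp only [Finset.mem_insert, Finset.mem_singleton, not_or, Finset.mem_univ, true_and] at hc hd
  refine ⟨c, d, Ne.symm hd.2.2, ?_, ?_⟩ <;>
    simp only [Finset.mem_powersetCard, Finset.subset_univ, true_and]
  · exact Finset.card_eq_three.2 ⟨a, b, c, hab, Ne.symm hc.1, Ne.symm hc.2, rfl⟩
  · exact Finset.card_eq_three.2 ⟨a, b, d, hab, Ne.symm hd.1, Ne.symm hd.2.1, rfl⟩

open Classical in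
/-- The product of all 3-graphs on `A` in which every pair has codegree at least two. -/
noncomputable def universalProduct (A : Type) [DecidableEq A] [Fintype A] :
    ThreeGraph (TwoCovered A → A) where
  edges := {e | #e = 3 ∧ ∀ i : TwoCovered A, e.image (fun v => v i) ∈ i.1}
  card_eq := fun _ he => (Finset.mem_filter.1 he).2.1

open Classical in
lemma mem_universalProduct {A : Type} [DecidableEq A] [Fintype A] [Nonempty (TwoCovered A)]
    {p q r : TwoCovered A → A} (h : ∀ i, {p i, q i, r i} ∈ i.1) :
    {p, q, r} ∈ (universalProduct A).edges := by
  have himage : ∀ i : TwoCovered A,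
      ({p, q, r} : Finset (TwoCovered A → A)).image (fun v => v i) = {p i, q i, r i} := by
    intro i; simp [Finset.image_insert]
  simp only [universalProduct, Finset.mem_filter, Finset.mem_univ, true_and]
  refine ⟨le_antisymm Finset.card_le_three ?_, fun i => himage i ▸ h i⟩
  obtain ⟨i⟩ := ‹Nonempty (TwoCovered A)›
  rw [← i.2.1 _ (h i), ← himage i]
  exact Finset.card_image_le

open Classical in
/-- No ordered two-colouring of the pairs turns every edge of the universal product into an
increasing triple whose bottom pair is red and whose other two pairs are blue. -/
lemma universalProduct_not_paletteColourable {A : Type} [DecidableEq A] [Fintype A]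
    [Nontrivial A] [Nonempty (TwoCovered A)] {L : Type*} [LinearOrder L]
    (lev : (TwoCovered A → A) → L) (red : (TwoCovered A → A) → (TwoCovered A → A) → Prop)
    (h : ∀ e ∈ (universalProduct A).edges, ∃ p q r, e = {p, q, r} ∧ lev p < lev q ∧
      lev q < lev r ∧ red p q ∧ ¬ red p r ∧ ¬ red q r) : False := by
  obtain ⟨y, -, hy⟩ := Finset.exists_max_image Finset.univ lev Finset.univ_nonempty
  have hne : (Finset.univ.filter fun x : TwoCovered A → A => ∀ i, x i ≠ y i).Nonempty := by
    choose x hx using fun i : TwoCovered A => exists_ne (y i)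
    exact ⟨x, by simpa using hx⟩
  obtain ⟨x, hx, hmax⟩ := Finset.exists_max_image _ lev hne
  simp only [Finset.mem_filter, Finset.mem_univ, true_and] at hx hmax hy
  choose w _ _ hw using fun i : TwoCovered A => i.2.2 (x i) (y i) (hx i)
  have hwE : ∀ i, {w i, x i, y i} ∈ i.1 := fun i => by
    convert (hw i).1 using 1
    grind
  have distinct : ∀ i, w i ≠ x i ∧ w i ≠ y i ∧ x i ≠ y i := fun i =>
    Finset.card_triple_eq_three_iff.1 (i.2.1 _ (hwE i))
  have hz : ∀ i : TwoCovered A, ∃ c, c ≠ y i ∧ {w i, x i, c} ∈ i.1 := by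
    intro i
    obtain ⟨c, d, hcd, hc, hd⟩ := i.2.2 (w i) (x i) (distinct i).1
    by_cases hcy : c = y i
    · exact ⟨d, hcy ▸ hcd.symm, hd⟩
    · exact ⟨c, hcy, hc⟩
  choose z hzy hzE using hz
  have hwx := hmax w fun i => (distinct i).2.1
  have hzx := hmax z hzy
  have key : lev w < lev x ∧ red w x := by
    obtain ⟨p, q, r, he, hpq, hqr, hred, -⟩ := h _ (mem_universalProduct hwE)
    obtain ⟨rfl, rfl, rfl⟩ := eq_of_triple_eq lev he hwx (hy x trivial) hpq hqr
    exact ⟨hpq, hred⟩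
  obtain ⟨p, q, r, he, hpq, hqr, -, hpr, hqr'⟩ := h _ (mem_universalProduct hzE)
  rcases le_total (lev w) (lev z) with hwz | hzw
  · rw [Finset.pair_comm x z] at he
    obtain ⟨rfl, rfl, rfl⟩ := eq_of_triple_eq lev he hwz hzx hpq hqr
    exact hpr key.2
  · rw [Finset.pair_comm x z, Finset.insert_comm] at he
    obtain ⟨rfl, rfl, rfl⟩ := eq_of_triple_eq lev he hzw key.1.le hpq hqr
    exact hqr' key.2

open Classical in
lemma not_hasCopy_paletteGraph {A : Type} [DecidableEq A] [Fintype A] [Nontrivial A]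
    [Nonempty (TwoCovered A)] {M n : ℕ} (σ : Fin n ≃ PaletteVertex M) :
    ¬ HasCopy (paletteGraph σ) (universalProduct A) := by
  rintro ⟨φ, hφ, hE⟩
  refine universalProduct_not_paletteColourable (fun v => (σ (φ v)).1)
    (fun v w => (σ (φ v)).2 (σ (φ w)).1 = 0) fun e he => ?_
  obtain ⟨p, q, r, hpqr, ⟨h1, h2⟩, h3, h4, h5⟩ := (Finset.mem_filter.1 (hE e he)).2
  have lift : ∀ s ∈ ({p, q, r} : Finset (Fin n)), ∃ v, φ v = s := by
    intro s hs
    rw [← hpqr] at hs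
    obtain ⟨v, -, hv⟩ := Finset.mem_image.1 hs
    exact ⟨v, hv⟩
  obtain ⟨p, rfl⟩ := lift p (by simp)
  obtain ⟨q, rfl⟩ := lift q (by simp)
  obtain ⟨r, rfl⟩ := lift r (by simp)
  refine ⟨p, q, r, Finset.image_injective hφ ?_, h1, h2, h3, h4, h5⟩
  rw [hpqr]
  simp [Finset.image_insert]

/-! ### Complete multipartite subsystems of dense systems of functions -/

lemma mul_card_filter_apply_eq_le {T : Type*} [Fintype T] [DecidableEq T] {n : ℕ} {a b : T}
    (hab : a ≠ b) : n * #{f : T → Fin n | f a = f b} ≤ n ^ Fintype.card T := by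
  have : n * #{f : T → Fin n | f a = f b} =
      #((Finset.univ : Finset (Fin n)) ×ˢ Finset.univ.filter fun f : T → Fin n => f a = f b) := by
    simp
  rw [this, show n ^ Fintype.card T = #(Finset.univ : Finset (T → Fin n)) by simp]
  refine Finset.card_le_card_of_injOn (fun t => Function.update t.2 a t.1) (by simp) ?_
  rintro ⟨x, f⟩ hf ⟨y, g⟩ hg h
  simp only [Finset.coe_product, Finset.coe_univ, Finset.coe_filter, Finset.mem_univ, true_and,
    Set.mem_prod, Set.mem_univ, Set.mem_ofPred_eq] at hf hg
  have hx : x = y := by simpa using congrFun h a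
  have off : ∀ c, c ≠ a → f c = g c := fun c hc => by simpa [hc] using congrFun h c
  have hfg : f = g := by
    funext c
    by_cases hc : c = a
    · rw [hc, hf, hg, off b hab.symm]
    · exact off c hc
  rw [hx, hfg]

lemma mul_card_filter_not_injective_le {T : Type*} [Fintype T] [DecidableEq T] (n : ℕ) :
    n * #{f : T → Fin n | ¬ Function.Injective f} ≤ Fintype.card T ^ 2 * n ^ Fintype.card T := by
  have hsub : (Finset.univ.filter fun f : T → Fin n => ¬ Function.Injective f) ⊆
      (Finset.univ.filter fun t : T × T => t.1 ≠ t.2).biUnion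
        fun t => Finset.univ.filter fun f : T → Fin n => f t.1 = f t.2 := by
    intro f hf
    obtain ⟨a, b, hab, hne⟩ := Function.not_injective_iff.1 (Finset.mem_filter.1 hf).2
    simp only [Finset.mem_biUnion, Finset.mem_filter, Finset.mem_univ, true_and]
    exact ⟨(a, b), hne, hab⟩
  calc n * #{f : T → Fin n | ¬ Function.Injective f}
      ≤ n * ∑ t : T × T with t.1 ≠ t.2, #{f : T → Fin n | f t.1 = f t.2} :=
        Nat.mul_le_mul_left _ ((Finset.card_le_card hsub).trans Finset.card_biUnion_le)
    _ = ∑ t : T × T with t.1 ≠ t.2, n * #{f : T → Fin n | f t.1 = f t.2} := Finset.mul_sum _ _ _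
    _ ≤ ∑ t : T × T with t.1 ≠ t.2, n ^ Fintype.card T :=
        Finset.sum_le_sum fun t ht => mul_card_filter_apply_eq_le (Finset.mem_filter.1 ht).2
    _ ≤ ∑ t : T × T, n ^ Fintype.card T :=
        Finset.sum_le_sum_of_subset (Finset.filter_subset _ _)
    _ = Fintype.card T ^ 2 * n ^ Fintype.card T := by simp [sq]

/-- In a dense relation between `Fin n` and `Y`, some `T`-indexed family of distinct elements has
a dense common neighbourhood. -/
lemma exists_injective_common_neighbourhood {T Y : Type*} [Fintype T] [DecidableEq T] [Nonempty T]
    [Fintype Y] [DecidableEq Y] {n : ℕ} {c : ℝ} (hc : 0 < c)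
    (hn : 2 * (Fintype.card T : ℝ) ^ 2 < c ^ Fintype.card T * n)
    (hY : Nonempty Y) (S : Finset (Fin n × Y)) (hS : c * (n * Fintype.card Y) ≤ #S) :
    ∃ τ : T → Fin n, Function.Injective τ ∧
      c ^ Fintype.card T / 2 * Fintype.card Y ≤ (#{y : Y | ∀ j, (τ j, y) ∈ S} : ℝ) := by
  by_contra! hcon
  set t := Fintype.card T with ht
  have htpos : 0 < t := Fintype.card_pos
  have hYpos : (0 : ℝ) < Fintype.card Y := by exact_mod_cast Fintype.card_pos
  have hnpos : (0 : ℝ) < n := by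
    rcases Nat.eq_zero_or_pos n with h | h
    · rw [h] at hn; simp only [Nat.cast_zero, mul_zero] at hn
      exact absurd hn (not_lt.2 (by positivity))
    · exact_mod_cast h
  let d : Y → ℕ := fun y => #{x : Fin n | (x, y) ∈ S}
  have hsum : ∑ y, d y = #S := by
    simp only [d, Finset.card_filter]
    rw [Finset.sum_comm, ← Fintype.sum_prod_type' (f := fun x y => if (x, y) ∈ S then 1 else 0)]
    simp
  have hcount : ∑ y, d y ^ t = ∑ τ : T → Fin n, #{y : Y | ∀ j, (τ j, y) ∈ S} := by
    simp only [Finset.card_filter (fun y => ∀ j, _)]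
    rw [Finset.sum_comm]
    refine Finset.sum_congr rfl fun y _ => ?_
    have hpi : Fintype.piFinset (fun _ : T => Finset.univ.filter fun x : Fin n => (x, y) ∈ S) =
        Finset.univ.filter fun τ : T → Fin n => ∀ j, (τ j, y) ∈ S := by
      ext τ
      simp
    rw [← Finset.card_filter, ← hpi, Fintype.card_piFinset]
    simp [d, ht]
  have hlow : Fintype.card Y * (c * n) ^ t ≤ ∑ y, (d y : ℝ) ^ t := by
    obtain ⟨k, hk⟩ := Nat.exists_eq_succ_of_ne_zero htpos.ne'
    have hmean := pow_sum_le_card_mul_sum_pow (s := Finset.univ) (f := fun y => (d y : ℝ))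
      (fun _ _ => Nat.cast_nonneg _) k
    rw [Finset.card_univ, ← Nat.cast_sum, hsum, ← Nat.succ_eq_add_one, ← hk] at hmean
    refine le_of_mul_le_mul_left (le_trans ?_ hmean) (pow_pos hYpos k)
    calc (Fintype.card Y : ℝ) ^ k * (Fintype.card Y * (c * n) ^ t)
        = (c * (n * Fintype.card Y)) ^ t := by rw [hk, Nat.succ_eq_add_one]; ring
      _ ≤ _ := by gcongr
  have hup : ∑ τ : T → Fin n, (#{y : Y | ∀ j, (τ j, y) ∈ S} : ℝ) ≤
      (n : ℝ) ^ t * (c ^ t / 2 * Fintype.card Y)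
        + #{f : T → Fin n | ¬ Function.Injective f} * Fintype.card Y := by
    rw [← Finset.sum_filter_add_sum_filter_not Finset.univ (fun τ : T → Fin n =>
      Function.Injective τ)]
    refine add_le_add ?_ ?_
    · refine (Finset.sum_le_card_nsmul _ _ (c ^ t / 2 * Fintype.card Y) fun τ hτ =>
        (hcon τ (Finset.mem_filter.1 hτ).2).le).trans ?_
      rw [nsmul_eq_mul]
      gcongr
      have : #{τ : T → Fin n | Function.Injective τ} ≤ n ^ t := by
        refine (Finset.card_le_univ _).trans ?_
        simp [ht]
      exact_mod_cast this
    · refine (Finset.sum_le_card_nsmul _ _ (Fintype.card Y : ℝ) fun τ _ => ?_).trans ?_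
      · exact_mod_cast Finset.card_le_univ _
      · rw [nsmul_eq_mul]
  have hinj : (n : ℝ) * #{f : T → Fin n | ¬ Function.Injective f} ≤ t ^ 2 * (n : ℝ) ^ t := by
    exact_mod_cast mul_card_filter_not_injective_le n
  have hall : (Fintype.card Y : ℝ) * (c * n) ^ t ≤ (n : ℝ) ^ t * (c ^ t / 2 * Fintype.card Y)
        + #{f : T → Fin n | ¬ Function.Injective f} * Fintype.card Y := by
    refine hlow.trans (le_trans (le_of_eq ?_) hup)
    exact_mod_cast hcount
  have h1 : (c * n) ^ t ≤ (n : ℝ) ^ t * (c ^ t / 2)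
      + #{f : T → Fin n | ¬ Function.Injective f} := by
    refine le_of_mul_le_mul_left ?_ hYpos
    linarith
  rw [mul_pow] at h1
  have h2 : n * (c ^ t * n ^ t) ≤ n * ((n : ℝ) ^ t * (c ^ t / 2)
      + #{f : T → Fin n | ¬ Function.Injective f}) := by gcongr
  have h3 : (n : ℝ) ^ t * (c ^ t * n) ≤ n ^ t * (2 * t ^ 2) := by linarith
  exact absurd (le_of_mul_le_mul_left h3 (by positivity)) (not_le.2 hn)

/-- A dense system of functions `A → Fin n` contains a complete multipartite system whose parts
are indexed by `T`. -/
lemma exists_box (T : Type) [Fintype T] [Nonempty T] (A : Type) [Finite A] :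
    ∀ c : ℝ, 0 < c → ∃ n₀ : ℕ, ∀ n, n₀ ≤ n → ∀ S : Finset (A → Fin n),
      c * (n : ℝ) ^ Nat.card A ≤ #S → ∃ g : A → T → Fin n,
        (∀ a, Function.Injective (g a)) ∧ ∀ j : A → T, (fun a => g a (j a)) ∈ S := by
  classical
  induction A using Finite.induction_empty_option with
  | of_equiv e ih =>
    intro c hc
    obtain ⟨n₀, h⟩ := ih c hc
    refine ⟨n₀, fun n hn S hS => ?_⟩
    obtain ⟨g, hg, hgS⟩ := h n hn (S.map (e.arrowCongr (Equiv.refl _)).symm.toEmbedding)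
      (by rwa [Finset.card_map, Nat.card_congr e])
    refine ⟨fun b => g (e.symm b), fun b => hg _, fun j => ?_⟩
    have := hgS fun a => j (e a)
    rw [Finset.mem_map_equiv] at this
    convert this using 1
    funext b
    simp [Equiv.arrowCongr]
  | h_empty =>
    intro c hc
    refine ⟨0, fun n _ S hS => ⟨isEmptyElim, isEmptyElim, fun j => ?_⟩⟩
    have : 0 < #S := by
      simp only [Nat.card_of_isEmpty, pow_zero, mul_one] at hS
      exact_mod_cast hc.trans_le hS
    obtain ⟨f, hf⟩ := Finset.card_pos.1 this
    rwa [Subsingleton.elim (fun a => _) f]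
  | @h_option α _ ih =>
    intro c hc
    obtain ⟨n₁, h₁⟩ := ih (c ^ Fintype.card T / 2) (by positivity)
    obtain ⟨n₂, h₂⟩ := exists_nat_gt (2 * (Fintype.card T : ℝ) ^ 2 / c ^ Fintype.card T)
    refine ⟨max n₁ (n₂ + 1), fun n hn S hS => ?_⟩
    have hn₂ : (n₂ : ℝ) ≤ n := by exact_mod_cast (by omega : n₂ ≤ n)
    have : NeZero n := ⟨by omega⟩
    have hcons : Function.Injective fun f : Option α → Fin n => (f none, fun a => f (some a)) := by
      intro f g h
      funext o
      cases o with
      | none => exact congrArg Prod.fst h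
      | some a => exact congrFun (congrArg Prod.snd h) a
    have hlarge : 2 * (Fintype.card T : ℝ) ^ 2 < c ^ Fintype.card T * n := by
      rw [div_lt_iff₀ (by positivity)] at h₂
      calc _ < _ := h₂
        _ ≤ n * c ^ Fintype.card T := by gcongr
        _ = _ := mul_comm _ _
    have hdense : c * (n * Fintype.card (α → Fin n)) ≤ #(S.map ⟨_, hcons⟩) := by
      rw [Finset.card_map]
      refine le_trans (le_of_eq ?_) hS
      rw [Finite.card_option, Fintype.card_fun, Fintype.card_fin, Nat.card_eq_fintype_card]
      push_cast
      ring
    obtain ⟨τ, hτ, hτS⟩ :=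
      exists_injective_common_neighbourhood (T := T) hc hlarge ⟨fun _ => 0⟩ _ hdense
    obtain ⟨g, hg, hgS⟩ := h₁ n (by omega) _ (by simpa using hτS)
    refine ⟨fun o => o.elim τ g, ?_, fun j => ?_⟩
    · rintro (_ | a)
      exacts [hτ, hg a]
    · have := (Finset.mem_filter.1 (hgS fun a => j (some a))).2 (j none)
      obtain ⟨f, hf, hfe₁, hfe₂⟩ := this
      convert hf using 1
      funext o
      cases o with
      | none => exact hfe₁.symm
      | some a => exact (congrFun hfe₂ a).symm

/-! ### Sampling -/

lemma card_filter_not_covered_le {n k : ℕ} (H : ThreeGraph (Fin n)) {ε : ℝ} (hε₀ : 0 ≤ ε)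
    (hε : ε ≤ 1)
    (hH : ∀ u v : Fin n, u ≠ v → ε * n ≤ codeg H u v) {a b : Bool × Fin k} (hab : a ≠ b)
    (s : Bool) :
    (#{f : Bool × Fin k → Fin n | f a ≠ f b ∧ ∀ c, {f a, f b, f (s, c)} ∉ H.edges} : ℝ)
      ≤ (1 - ε) ^ (k - 2) * (n : ℝ) ^ (2 * k) := by
  classical
  rcases Nat.eq_zero_or_pos n with rfl | hn
  · have : IsEmpty (Bool × Fin k → Fin 0) := ⟨fun f => (f a).elim0⟩
    rw [Finset.eq_empty_of_isEmpty (Finset.filter _ _)]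
    have : 0 ≤ 1 - ε := by linarith
    simp only [Finset.card_empty, Nat.cast_zero]
    positivity
  have hnpos : (0 : ℝ) < n := by exact_mod_cast hn
  have hρ : 0 ≤ 1 - ε := by linarith
  let t : Fin n × Fin n → Bool × Fin k → Finset (Fin n) := fun z i =>
    if i = a then {z.1} else if i = b then {z.2} else
      if i.1 = s then Finset.univ.filter (fun w => {z.1, z.2, w} ∉ H.edges) else Finset.univ
  have hsub : (Finset.univ.filter fun f : Bool × Fin k → Fin n =>
      f a ≠ f b ∧ ∀ c, {f a, f b, f (s, c)} ∉ H.edges) ⊆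
      (Finset.univ.filter fun z : Fin n × Fin n => z.1 ≠ z.2).biUnion
        fun z => Fintype.piFinset (t z) := by
    intro f hf
    obtain ⟨hne, hf⟩ := (Finset.mem_filter.1 hf).2
    refine Finset.mem_biUnion.2 ⟨(f a, f b), by simpa using hne, Fintype.mem_piFinset.2 ?_⟩
    rintro ⟨s', c⟩
    simp only [t]
    split_ifs with h1 h2 h3
    · simp [h1]
    · simp [h2]
    · obtain rfl : s' = s := h3
      simpa using hf c
    · simp
  have hfactor : ∀ z : Fin n × Fin n, z.1 ≠ z.2 → ∀ i : Bool × Fin k,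
      (#(t z i) : ℝ) * (if i ∈ ({a, b} : Finset _) then (n : ℝ) else 1) ≤
        n * (if i ∈ ({s} ×ˢ Finset.univ) \ ({a, b} : Finset (Bool × Fin k)) then 1 - ε else 1) := by
    intro z hz i
    by_cases hia : i = a
    · simp [t, hia]
    by_cases hib : i = b
    · simp [t, hib, hab.symm]
    by_cases his : i.1 = s
    · have hcard : #(t z i) + codeg H z.1 z.2 = n := by
        simp only [t, hia, hib, his, if_true, if_false, codeg]
        rw [add_comm, Finset.card_filter_add_card_filter_not]
        simp
      have hco := hH _ _ hz
      have : (#(t z i) : ℝ) + codeg H z.1 z.2 = n := by exact_mod_cast hcard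
      simp only [hia, hib, his, Finset.mem_insert, Finset.mem_singleton, or_self, if_false, mul_one,
        Finset.mem_sdiff, Finset.mem_product, Finset.mem_univ, and_self, not_false_iff, if_true]
      linarith
    · have hi : i ∉ ({s} ×ˢ Finset.univ) \ ({a, b} : Finset (Bool × Fin k)) := by
        simp only [Finset.mem_sdiff, Finset.mem_product, Finset.mem_singleton, his, false_and,
          not_false_iff]
      rw [if_neg hi]
      simp [t, hia, hib, his]
  have hprod : ∀ z : Fin n × Fin n, z.1 ≠ z.2 →
      (#(Fintype.piFinset (t z)) : ℝ) * (n : ℝ) ^ 2 ≤ (1 - ε) ^ (k - 2) * (n : ℝ) ^ (2 * k) := by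
    intro z hz
    have := Finset.prod_le_prod (s := Finset.univ) (fun i _ => by positivity)
      fun i _ => hfactor z hz i
    rw [Finset.prod_mul_distrib, Finset.prod_mul_distrib, Finset.prod_ite_mem, Finset.prod_ite_mem,
      Finset.univ_inter, Finset.univ_inter, Finset.prod_const, Finset.prod_const,
      Finset.prod_const, Finset.card_pair hab, ← Nat.cast_prod, ← Fintype.card_piFinset] at this
    refine this.trans ?_
    rw [mul_comm]
    have hcard : k - 2 ≤ #(({s} ×ˢ Finset.univ) \ ({a, b} : Finset (Bool × Fin k))) := by
      have := Finset.le_card_sdiff ({a, b} : Finset (Bool × Fin k)) ({s} ×ˢ Finset.univ)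
      rwa [Finset.card_pair hab, Finset.card_product, Finset.card_singleton, one_mul,
        Finset.card_univ, Fintype.card_fin] at this
    have huniv : #(Finset.univ : Finset (Bool × Fin k)) = 2 * k := by simp
    rw [huniv]
    gcongr ?_ * _
    exact pow_le_pow_of_le_one hρ (by linarith) hcard
  have hsum : (#{f : Bool × Fin k → Fin n | f a ≠ f b ∧ ∀ c, {f a, f b, f (s, c)} ∉ H.edges} : ℝ)
      ≤ ∑ z : Fin n × Fin n with z.1 ≠ z.2, (#(Fintype.piFinset (t z)) : ℝ) := by
    exact_mod_cast (Finset.card_le_card hsub).trans Finset.card_biUnion_le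
  refine le_of_mul_le_mul_right ?_ (pow_pos hnpos 2)
  calc _ ≤ (∑ z : Fin n × Fin n with z.1 ≠ z.2, (#(Fintype.piFinset (t z)) : ℝ)) * (n : ℝ) ^ 2 := by
        gcongr
    _ = ∑ z : Fin n × Fin n with z.1 ≠ z.2, (#(Fintype.piFinset (t z)) : ℝ) * (n : ℝ) ^ 2 :=
        Finset.sum_mul _ _ _
    _ ≤ ∑ z : Fin n × Fin n with z.1 ≠ z.2, (1 - ε) ^ (k - 2) * (n : ℝ) ^ (2 * k) :=
        Finset.sum_le_sum fun z hz => hprod z (Finset.mem_filter.1 hz).2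
    _ ≤ ∑ z : Fin n × Fin n, (1 - ε) ^ (k - 2) * (n : ℝ) ^ (2 * k) :=
        Finset.sum_le_sum_of_subset_of_nonneg (Finset.filter_subset _ _)
          fun _ _ _ => by positivity
    _ = _ := by simp; ring

/-- Most samples from a 3-graph of large codegree are injective and give a 3-graph in which every
pair is covered from both halves of the index set. -/
lemma half_le_card_covered {n k : ℕ} (H : ThreeGraph (Fin n)) {ε : ℝ} (hε₀ : 0 ≤ ε) (hε : ε ≤ 1)
    (hH : ∀ u v : Fin n, u ≠ v → ε * n ≤ codeg H u v)
    (hk : 8 * (k : ℝ) ^ 2 * (1 - ε) ^ (k - 2) ≤ 1 / 4) (hn₀ : 0 < n) (hn : 16 * k ^ 2 ≤ n) :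
    (n : ℝ) ^ (2 * k) / 2 ≤ #{f : Bool × Fin k → Fin n |
      ∀ a b, a ≠ b → ∀ s, ∃ c, {f a, f b, f (s, c)} ∈ H.edges} := by
  classical
  have hnpos : (0 : ℝ) < n := by exact_mod_cast hn₀
  let bad : (Bool × Fin k) × (Bool × Fin k) × Bool → Finset (Bool × Fin k → Fin n) := fun t =>
    {f | f t.1 ≠ f t.2.1 ∧ ∀ c, {f t.1, f t.2.1, f (t.2.2, c)} ∉ H.edges}
  let idx : Finset ((Bool × Fin k) × (Bool × Fin k) × Bool) := {t | t.1 ≠ t.2.1}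
  have hcover : (Finset.univ : Finset (Bool × Fin k → Fin n)) ⊆
      (Finset.univ.filter fun f => ∀ a b, a ≠ b → ∀ s, ∃ c, {f a, f b, f (s, c)} ∈ H.edges) ∪
      ((Finset.univ.filter fun f => ¬ Function.Injective f) ∪ idx.biUnion bad) := by
    intro f _
    by_contra hf
    simp only [Finset.mem_union, Finset.mem_filter, Finset.mem_univ, true_and, not_or, not_not,
      Finset.mem_biUnion, idx, bad] at hf
    obtain ⟨h1, h2, h3⟩ := hf
    refine h1 fun a b hab s => ?_
    by_contra! hc
    exact h3 ⟨(a, b, s), hab, h2.ne hab, hc⟩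
  have hcard : (n : ℝ) ^ (2 * k) ≤ #{f : Bool × Fin k → Fin n |
      ∀ a b, a ≠ b → ∀ s, ∃ c, {f a, f b, f (s, c)} ∈ H.edges}
      + (#{f : Bool × Fin k → Fin n | ¬ Function.Injective f} + ∑ t ∈ idx, (#(bad t) : ℝ)) := by
    have h := (Finset.card_le_card hcover).trans ((Finset.card_union_le _ _).trans
      (Nat.add_le_add_left ((Finset.card_union_le _ _).trans
        (Nat.add_le_add_left Finset.card_biUnion_le _)) _))
    rw [Finset.card_univ, Fintype.card_fun, Fintype.card_prod, Fintype.card_bool, Fintype.card_fin,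
      Fintype.card_fin] at h
    exact_mod_cast h
  have hbad : ∑ t ∈ idx, (#(bad t) : ℝ) ≤ 1 / 4 * (n : ℝ) ^ (2 * k) := by
    have hρ : 0 ≤ 1 - ε := by linarith
    calc ∑ t ∈ idx, (#(bad t) : ℝ) ≤ ∑ t ∈ idx, (1 - ε) ^ (k - 2) * (n : ℝ) ^ (2 * k) :=
          Finset.sum_le_sum fun t ht =>
            card_filter_not_covered_le H hε₀ hε hH (Finset.mem_filter.1 ht).2 _
      _ ≤ ∑ t, (1 - ε) ^ (k - 2) * (n : ℝ) ^ (2 * k) :=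
          Finset.sum_le_sum_of_subset_of_nonneg (Finset.filter_subset _ _)
            fun _ _ _ => by positivity
      _ = (8 * (k : ℝ) ^ 2 * (1 - ε) ^ (k - 2)) * (n : ℝ) ^ (2 * k) := by simp; ring
      _ ≤ _ := by gcongr
  have hinj : (#{f : Bool × Fin k → Fin n | ¬ Function.Injective f} : ℝ) ≤
      1 / 4 * (n : ℝ) ^ (2 * k) := by
    have h := mul_card_filter_not_injective_le (T := Bool × Fin k) n
    rw [Fintype.card_prod, Fintype.card_bool, Fintype.card_fin] at h
    have h' : (n : ℝ) * #{f : Bool × Fin k → Fin n | ¬ Function.Injective f} ≤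
        (2 * k) ^ 2 * (n : ℝ) ^ (2 * k) := by exact_mod_cast h
    have hn' : 16 * (k : ℝ) ^ 2 ≤ n := by exact_mod_cast hn
    refine le_of_mul_le_mul_left (h'.trans ?_) hnpos
    calc (2 * (k : ℝ)) ^ 2 * (n : ℝ) ^ (2 * k)
        = (16 * (k : ℝ) ^ 2) * (1 / 4 * (n : ℝ) ^ (2 * k)) := by ring
      _ ≤ _ := by gcongr
  linarith

open Classical in
lemma hasCopy_universalProduct_of_box {A : Type} [DecidableEq A] [Fintype A] {n : ℕ}
    (H : ThreeGraph (Fin n)) (i : TwoCovered A) (g : A → (TwoCovered A → A) → Fin n)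
    (hg : ∀ a, Function.Injective (g a))
    (hbox : ∀ j : A → TwoCovered A → A, ∀ e ∈ i.1, e.image (fun a => g a (j a)) ∈ H.edges) :
    HasCopy H (universalProduct A) := by
  refine ⟨fun v => g (v i) v, fun p q hpq => ?_, fun e he => ?_⟩
  · by_cases hi : p i = q i
    · simp only [hi] at hpq
      exact hg _ hpq
    · obtain ⟨c, -, -, hc, -⟩ := i.2.2 _ _ hi
      have h := H.card_eq _ (hbox (fun a => if a = p i then p else q) _ hc)
      simp only [Finset.image_insert, Finset.image_singleton, if_true, Ne.symm hi, if_false] at h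
      exact absurd hpq (Finset.card_triple_eq_three_iff.1 h).1
  · obtain ⟨hcard, himage⟩ := (Finset.mem_filter.1 he).2
    have hinj : Set.InjOn (fun v : TwoCovered A → A => v i) e := by
      rw [← Finset.card_image_iff, hcard]
      exact i.2.1 _ (himage i)
    have hne : Nonempty (TwoCovered A → A) := by
      obtain ⟨v, -⟩ := Finset.card_pos.1 (by omega : 0 < #e)
      exact ⟨v⟩
    have h := hbox (Function.invFunOn (fun v : TwoCovered A → A => v i) e) _ (himage i)
    rw [Finset.image_image] at h
    convert h using 1
    refine Finset.image_congr fun v hv => ?_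
    simp only [Function.comp]
    rw [hinj.leftInvOn_invFunOn hv]

lemma exists_hasCopy_universalProduct {ε : ℝ} (hε₀ : 0 < ε) (hε : ε ≤ 1) {k : ℕ} (hk₂ : 2 ≤ k)
    (hk : 8 * (k : ℝ) ^ 2 * (1 - ε) ^ (k - 2) ≤ 1 / 4) :
    ∃ n₀ : ℕ, ∀ n, n₀ ≤ n → ∀ H : ThreeGraph (Fin n),
      (∀ u v : Fin n, u ≠ v → ε * n ≤ codeg H u v) →
        HasCopy H (universalProduct (Bool × Fin k)) := by
  classical
  have hne : Nonempty (TwoCovered (Bool × Fin k)) := nonempty_twoCovered (by simp; omega)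
  have : NeZero k := ⟨by omega⟩
  have hN : (0 : ℝ) < Fintype.card (TwoCovered (Bool × Fin k)) := by
    exact_mod_cast Fintype.card_pos
  obtain ⟨n₁, hbox⟩ := exists_box (TwoCovered (Bool × Fin k) → Bool × Fin k) (Bool × Fin k)
    (1 / (2 * Fintype.card (TwoCovered (Bool × Fin k)))) (by positivity)
  refine ⟨max n₁ (16 * k ^ 2 + 1), fun n hn H hH => ?_⟩
  have hgood := half_le_card_covered H hε₀.le hε hH hk (by omega) (by omega)
  let S : TwoCovered (Bool × Fin k) → Finset (Bool × Fin k → Fin n) := fun i =>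
    {f | ∀ e ∈ i.1, e.image f ∈ H.edges}
  have hcover : (Finset.univ.filter fun f : Bool × Fin k → Fin n =>
      ∀ a b, a ≠ b → ∀ s, ∃ c, {f a, f b, f (s, c)} ∈ H.edges) ⊆ Finset.univ.biUnion S := by
    intro f hf
    replace hf := (Finset.mem_filter.1 hf).2
    have hlift : ∀ a b c, {f a, f b, f c} ∈ H.edges →
        {a, b, c} ∈ Finset.univ.filter fun e => #e = 3 ∧ e.image f ∈ H.edges := by
      intro a b c habc
      have himage : ({a, b, c} : Finset (Bool × Fin k)).image f = {f a, f b, f c} := by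
        simp [Finset.image_insert]
      refine Finset.mem_filter.2 ⟨Finset.mem_univ _, le_antisymm Finset.card_le_three ?_,
        himage ▸ habc⟩
      rw [← H.card_eq _ habc, ← himage]
      exact Finset.card_image_le
    refine Finset.mem_biUnion.2 ⟨⟨Finset.univ.filter fun e => #e = 3 ∧ e.image f ∈ H.edges,
      fun e he => (Finset.mem_filter.1 he).2.1, fun a b hab => ?_⟩, Finset.mem_univ _, ?_⟩
    · obtain ⟨c, hc⟩ := hf a b hab true
      obtain ⟨d, hd⟩ := hf a b hab false
      exact ⟨(true, c), (false, d), by simp, hlift _ _ _ hc, hlift _ _ _ hd⟩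
    · exact Finset.mem_filter.2 ⟨Finset.mem_univ _, fun e he => (Finset.mem_filter.1 he).2.2⟩
  have hsum : (n : ℝ) ^ (2 * k) / 2 ≤ ∑ i, (#(S i) : ℝ) := by
    refine hgood.trans ?_
    exact_mod_cast (Finset.card_le_card hcover).trans Finset.card_biUnion_le
  obtain ⟨i, -, hi⟩ : ∃ i ∈ (Finset.univ : Finset (TwoCovered (Bool × Fin k))),
      1 / (2 * Fintype.card (TwoCovered (Bool × Fin k))) * (n : ℝ) ^ (2 * k) ≤ #(S i) := by
    refine Finset.exists_le_of_sum_le Finset.univ_nonempty (le_trans (le_of_eq ?_) hsum)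
    rw [Finset.sum_const, Finset.card_univ, nsmul_eq_mul]
    field_simp
  obtain ⟨g, hg, hgS⟩ := hbox n (by omega) (S i) (by simpa using hi)
  exact hasCopy_universalProduct_of_box H i g hg fun j => (Finset.mem_filter.1 (hgS j)).2

lemma exists_sample_size {ε : ℝ} (hε₀ : 0 < ε) (hε : ε ≤ 1) :
    ∃ k : ℕ, 2 ≤ k ∧ 8 * (k : ℝ) ^ 2 * (1 - ε) ^ (k - 2) ≤ 1 / 4 := by
  have h := tendsto_pow_const_mul_const_pow_of_lt_one 2 (sub_nonneg.2 hε)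
    (by linarith : 1 - ε < 1)
  obtain ⟨j, hj, hj₁⟩ := ((h.eventually_lt_const (by norm_num : (0 : ℝ) < 1 / 288)).and
    (Filter.eventually_ge_atTop 1)).exists
  refine ⟨j + 2, by omega, ?_⟩
  have hj₁' : (1 : ℝ) ≤ j := by exact_mod_cast hj₁
  have hρ : 0 ≤ (1 - ε) ^ j := pow_nonneg (sub_nonneg.2 hε) j
  have hsq : ((j : ℝ) + 2) ^ 2 ≤ 9 * j ^ 2 := by nlinarith
  push_cast
  calc 8 * ((j : ℝ) + 2) ^ 2 * (1 - ε) ^ j ≤ 8 * (9 * j ^ 2) * (1 - ε) ^ j := by gcongr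
    _ = 72 * (j ^ 2 * (1 - ε) ^ j) := by ring
    _ ≤ 1 / 4 := by linarith

/-! ### Relabelling and conclusion -/

/-- A 3-graph with its vertices relabelled along an equivalence. -/
def ThreeGraph.relabel {V W : Type*} (F : ThreeGraph V) (σ : V ≃ W) : ThreeGraph W where
  edges := F.edges.map (Equiv.finsetCongr σ).toEmbedding
  card_eq := by
    intro e he
    obtain ⟨e', he', rfl⟩ := Finset.mem_map.1 he
    simpa using F.card_eq e' he'

lemma hasCopy_relabel_iff {V W U : Type*} [DecidableEq U] (H : ThreeGraph U) (F : ThreeGraph V)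
    (σ : V ≃ W) : HasCopy H (F.relabel σ) ↔ HasCopy H F := by
  classical
  constructor
  · rintro ⟨φ, hφ, hE⟩
    refine ⟨φ ∘ σ, hφ.comp σ.injective, fun e he => ?_⟩
    have := hE _ (Finset.mem_map.2 ⟨e, he, rfl⟩)
    simpa [Finset.map_eq_image, Finset.image_image] using this
  · rintro ⟨φ, hφ, hE⟩
    refine ⟨φ ∘ σ.symm, hφ.comp σ.symm.injective, fun e he => ?_⟩
    obtain ⟨e', he', rfl⟩ := Finset.mem_map.1 he
    simpa [Finset.map_eq_image, Finset.image_image, Function.comp_def] using hE e' he'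

lemma four_div_27_le_piUnif {V : Type*} (F : ThreeGraph V)
    (hF : ∀ (M n : ℕ) (σ : Fin n ≃ PaletteVertex M), ¬ HasCopy (paletteGraph σ) F) :
    4 / 27 ≤ piUnif F := by
  refine le_csSup ⟨1, fun d hd => hd.2.1⟩ ⟨by norm_num, by norm_num, fun η hη n₀ => ?_⟩
  obtain ⟨m, hm⟩ := exists_nat_gt ((2 / η) ^ 2)
  let M := max (m + 1) n₀
  have hM : 0 < M := by simp [M]
  let σ : Fin (M * 3 ^ M) ≃ PaletteVertex M :=
    (finCongr (card_paletteVertex M).symm).trans (Fintype.equivFin _).symm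
  refine ⟨M * 3 ^ M, ?_, paletteGraph σ, hF _ _ σ, uniformlyDense_paletteGraph σ hM ?_⟩
  · exact (le_max_right _ _).trans (Nat.le_mul_of_pos_right M (by positivity))
  · rw [← div_le_iff₀' hη]
    refine Real.le_sqrt_of_sq_le (hm.le.trans ?_)
    exact_mod_cast (Nat.le_succ m).trans (le_max_left _ _)

lemma piCo_le_of_hasCopy {V : Type*} (F : ThreeGraph V) {ε : ℝ} (hε : 0 ≤ ε)
    (hF : ε ≤ 1 → ∃ n₀ : ℕ, ∀ n, n₀ ≤ n → ∀ H : ThreeGraph (Fin n),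
      (∀ u v : Fin n, u ≠ v → ε * n ≤ codeg H u v) → HasCopy H F) :
    piCo F ≤ ε := by
  refine Real.sSup_le (fun x hx => ?_) hε
  obtain ⟨-, hx₁, hx⟩ := hx
  by_contra! hlt
  obtain ⟨n₀, h⟩ := hF (hlt.le.trans hx₁)
  obtain ⟨n, hn, H, hfree, hco⟩ := hx n₀
  refine hfree (h n hn H fun u v huv => le_trans ?_ (hco u v huv))
  gcongr

/-- For every real `ε > 0` there exists a 3-graph `F` with uniform Turán density at least
`4/27` and codegree Turán density at most `ε`. -/
theorem stmt0 (ε : ℝ) (hε : 0 < ε) :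
    ∃ (n : ℕ) (F : ThreeGraph (Fin n)), 4 / 27 ≤ piUnif F ∧ piCo F ≤ ε := by
  classical
  obtain ⟨k, hk₂, hk⟩ := exists_sample_size (lt_min hε one_pos) (min_le_right ε 1)
  have : Nonempty (TwoCovered (Bool × Fin k)) := nonempty_twoCovered (by simp; omega)
  have : NeZero k := ⟨by omega⟩
  let F := universalProduct (Bool × Fin k)
  refine ⟨_, F.relabel (Fintype.equivFin _), four_div_27_le_piUnif _ fun M n σ => ?_,
    piCo_le_of_hasCopy _ hε.le fun hε₁ => ?_⟩
  · rw [hasCopy_relabel_iff]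
    exact not_hasCopy_paletteGraph σ
  · simp only [hasCopy_relabel_iff]
    rw [min_eq_left hε₁] at hk
    exact exists_hasCopy_universalProduct hε hε₁ hk₂ hk
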